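/- Fix ξ > 0. For every strictly positive probability vector π̃ = (π̃_h)_{h ∈ H*} on H*, there exists a unique strictly positive probability vector π = (π_h)_{h ∈ H} on H such that ∏_{h ∈ H} π_h^{I_odd(h)} / ∏_{h ∈ H} π_h^{I_even(h)} = ξ and π_h/(1-π_0) = π̃_h for all h ∈ H*, where π_0 is the value of π at h = (0,...,0). Explicitly, π_0 = (Π̃_odd/Π̃_even)/(ξ + Π̃_odd/Π̃_even) and π_h = (1-π_0) π̃_h for h ∈ H*, where Π̃_odd = ∏_{h ∈ H*} π̃_h^{I_odd(h)} and Π̃_even = ∏_{h ∈ H*} π̃_h^{I_even(h)}. (That is, the model fixing the highest-order interaction at ξ is nonparametric identified: it places no restriction on the observed-data distribution and determines the unobserved cell probability.) -/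

import Mathlib

open Finset

/-- `H* = {0,1}^K \ {(0,...,0)}` as a finset. -/
def Hstar (K : ℕ) : Finset (Fin K → Bool) :=
  Finset.univ.filter (fun h => h ≠ (fun _ => false))

/-- `∏_{h ∈ s} p(h)^{I_odd(h)}`, where `I_odd(h) = I(∑_k h_k odd)`. -/
noncomputable def pOdd {K : ℕ} (s : Finset (Fin K → Bool)) (p : (Fin K → Bool) → ℝ) : ℝ :=
  ∏ h ∈ s, if Odd (∑ k, (h k).toNat) then p h else 1

/-- `∏_{h ∈ s} p(h)^{I_even(h)}`, where `I_even(h) = I(∑_k h_k even)`. -/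
noncomputable def pEven {K : ℕ} (s : Finset (Fin K → Bool)) (p : (Fin K → Bool) → ℝ) : ℝ :=
  ∏ h ∈ s, if Even (∑ k, (h k).toNat) then p h else 1


theorem aux_univ {K : ℕ} (f : (Fin K → Bool) → ℝ) :
    ∏ h, f h = f (fun _ => false) * ∏ h ∈ Hstar K, f h := by
  have : Hstar K = Finset.univ.erase (fun _ => false) := by
    ext h; simp [Hstar]
  rw [this, Finset.mul_prod_erase _ _ (Finset.mem_univ _)]

theorem aux_univ_sum {K : ℕ} (f : (Fin K → Bool) → ℝ) :
    ∑ h, f h = f (fun _ => false) + ∑ h ∈ Hstar K, f h := by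
  have : Hstar K = Finset.univ.erase (fun _ => false) := by
    ext h; simp [Hstar]
  rw [this, Finset.add_sum_erase _ _ (Finset.mem_univ _)]

theorem aux_flip {K : ℕ} (hK : 1 ≤ K) (c : ℝ) :
    pOdd (Finset.univ : Finset (Fin K → Bool)) (fun _ => c) =
      pEven (Finset.univ : Finset (Fin K → Bool)) (fun _ => c) := by
  obtain ⟨n, rfl⟩ : ∃ n, K = n + 1 := ⟨K - 1, by omega⟩
  unfold pOdd pEven
  have hinv : Function.Involutive
      (fun h : Fin (n+1) → Bool => Function.update h 0 (!(h 0))) := by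
    intro h
    simp
  refine Fintype.prod_equiv (hinv.toPerm _) _ _ ?_
  intro h
  have : Odd (∑ k, (h k).toNat) ↔ Even (∑ k, ((hinv.toPerm _) h k).toNat) := by
    simp only [Function.Involutive.coe_toPerm, Fin.sum_univ_succ, Function.update_self,
      ne_eq, Fin.succ_ne_zero, not_false_eq_true, Function.update_of_ne]
    cases h 0 <;> simp [Nat.even_add_one, Nat.odd_add_one, add_comm 1]
  simp only [this]

theorem aux_pos {K : ℕ} (tπ : (Fin K → Bool) → ℝ)
    (htπ : ∀ h ∈ Hstar K, tπ h ∈ Set.Ioo (0 : ℝ) 1) :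
    0 < pOdd (Hstar K) tπ ∧ 0 < pEven (Hstar K) tπ := by
  constructor
  all_goals
    refine Finset.prod_pos fun h hh => ?_
    have := (htπ h hh).1
    split_ifs
    · exact this
    · exact one_pos

theorem aux_ratio {K : ℕ} (hK : 1 ≤ K) (tπ π : (Fin K → Bool) → ℝ) (c : ℝ) (hc : 0 < c)
    (h : ∀ h ∈ Hstar K, π h = c * tπ h) :
    pOdd Finset.univ π / pEven Finset.univ π =
      c / π (fun _ => false) * (pOdd (Hstar K) tπ / pEven (Hstar K) tπ) := by
  have h1 : pOdd Finset.univ π = pOdd (Hstar K) (fun _ => c) * pOdd (Hstar K) tπ := by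
    unfold pOdd
    rw [aux_univ, ← Finset.prod_mul_distrib]
    simp only [Bool.toNat_false, Finset.sum_const_zero, Nat.not_odd_zero, if_false, one_mul]
    refine Finset.prod_congr rfl fun x hx => ?_
    split_ifs <;> simp [h x hx]
  have h2 : pEven Finset.univ π =
      π (fun _ => false) * (pEven (Hstar K) (fun _ => c) * pEven (Hstar K) tπ) := by
    unfold pEven
    rw [aux_univ, ← Finset.prod_mul_distrib]
    simp only [Bool.toNat_false, Finset.sum_const_zero, Even.zero, if_true]
    congr 1
    refine Finset.prod_congr rfl fun x hx => ?_
    split_ifs <;> simp [h x hx]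
  have h3 : pOdd (Hstar K) (fun _ => c) = c * pEven (Hstar K) (fun _ => c) := by
    have := aux_flip hK c
    unfold pOdd pEven at *
    rw [aux_univ, aux_univ] at this
    simpa using this
  have h4 : 0 < pEven (Hstar K) (fun _ => c) := by
    refine Finset.prod_pos fun h hh => ?_
    split_ifs
    · exact hc
    · exact one_pos
  rw [h1, h2, h3]
  have : pEven (Hstar K) (fun _ => c) ≠ 0 := h4.ne'
  generalize pEven (Hstar K) (fun _ => c) = B at *
  rw [div_mul_div_comm, show c * B * pOdd (Hstar K) tπ = B * (c * pOdd (Hstar K) tπ) by ring,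
    show π (fun _ => false) * (B * pEven (Hstar K) tπ)
      = B * (π (fun _ => false) * pEven (Hstar K) tπ) by ring, mul_div_mul_left _ _ this]

/-- fixing the highest-order interaction at `ξ > 0` is a nonparametric
identified assumption. For every strictly positive probability vector `π̃` on `H*` there
is a unique strictly positive probability vector `π` on `H` with
`Π_odd/Π_even = ξ` and `π_h/(1-π_0) = π̃_h` for all `h ∈ H*`; explicitly,
`π_0 = (Π̃_odd/Π̃_even)/(ξ + Π̃_odd/Π̃_even)` and `π_h = (1-π_0) π̃_h` for `h ∈ H*`.
The property of being such a `π` is abstracted as the predicate `P`. -/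
theorem stmt19 (K : ℕ) (hK : 1 ≤ K) (ξ : ℝ) (hξ : 0 < ξ)
    (tπ : (Fin K → Bool) → ℝ)
    (htπ : ∀ h ∈ Hstar K, tπ h ∈ Set.Ioo (0 : ℝ) 1)
    (hsum : ∑ h ∈ Hstar K, tπ h = 1)
    (P : ((Fin K → Bool) → ℝ) → Prop)
    (hP : ∀ π : (Fin K → Bool) → ℝ, P π ↔
      ((∀ h, π h ∈ Set.Ioo (0 : ℝ) 1) ∧ (∑ h, π h = 1) ∧
        pOdd Finset.univ π / pEven Finset.univ π = ξ ∧
        (∀ h ∈ Hstar K, π h / (1 - π (fun _ => false)) = tπ h))) :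
    (∃! π : (Fin K → Bool) → ℝ, P π) ∧
      P (fun h => if h = (fun _ => false) then
            (pOdd (Hstar K) tπ / pEven (Hstar K) tπ) /
              (ξ + pOdd (Hstar K) tπ / pEven (Hstar K) tπ)
          else
            (1 - (pOdd (Hstar K) tπ / pEven (Hstar K) tπ) /
                (ξ + pOdd (Hstar K) tπ / pEven (Hstar K) tπ)) * tπ h) := by
  obtain ⟨ho, he⟩ := aux_pos tπ htπ
  have hR : 0 < pOdd (Hstar K) tπ / pEven (Hstar K) tπ := div_pos ho he
  have key := aux_ratio hK tπ
  generalize pOdd (Hstar K) tπ / pEven (Hstar K) tπ = R at *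
  have hq0 : 0 < R / (ξ + R) := by positivity
  have hq1 : 1 - R / (ξ + R) = ξ / (ξ + R) := by field_simp; ring
  have hc0 : 0 < 1 - R / (ξ + R) := by rw [hq1]; positivity
  have hne : ∀ h ∈ Hstar K, h ≠ (fun _ => false) := by
    intro h hh; simpa [Hstar] using hh
  have hmem : ∀ h : Fin K → Bool, h ≠ (fun _ => false) → h ∈ Hstar K := by
    intro h hh; simpa [Hstar] using hh
  refine (fun hex => ⟨⟨_, hex, ?_⟩, hex⟩) ?_
  on_goal 1 => beta_reduce
  rotate_left
  · intro π hπ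
    obtain ⟨hpos, hs, hr, hcond⟩ := (hP π).1 hπ
    have h0 := hpos (fun _ => false)
    have hc : 0 < 1 - π (fun _ => false) := by linarith [h0.2]
    have hmul : ∀ h ∈ Hstar K, π h = (1 - π (fun _ => false)) * tπ h := by
      intro h hh
      rw [← hcond h hh]
      field_simp
    have hk := key π _ hc hmul
    rw [hr] at hk
    have h00 : π (fun _ => false) = R / (ξ + R) := by
      have := h0.1
      rw [eq_div_iff (by positivity)]
      field_simp at hk
      linarith
    funext h
    by_cases hh : h = (fun _ => false)
    · rw [if_pos hh, hh, h00]
    · rw [if_neg hh, hmul h (hmem h hh), h00]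
  · beta_reduce
    rw [hP]
    refine ⟨?_, ?_, ?_, ?_⟩
    · intro h
      by_cases hh : h = (fun _ => false)
      · simp only [if_pos hh]
        exact ⟨hq0, by linarith⟩
      · simp only [if_neg hh]
        obtain ⟨a, b⟩ := htπ h (hmem h hh)
        exact ⟨by positivity, by nlinarith⟩
    · rw [aux_univ_sum, if_pos rfl,
        Finset.sum_congr rfl (fun h hh => if_neg (hne h hh)), ← Finset.mul_sum, hsum]
      ring
    · rw [key _ _ hc0 (fun h hh => if_neg (hne h hh)), if_pos rfl, hq1]
      field_simp
    · intro h hh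
      rw [if_neg (hne h hh), if_pos rfl, mul_div_cancel_left₀ _ hc0.ne']
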